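/- arXiv:2008.05815 — 2 statements merged into one kernel-verified Lean document; each statement's English description precedes it below -/
import Mathlib

section
/- As t → ∞, the number of polynomials in R_2(t) satisfies t² log t ≪ |R_2(t)| ≪ t² log t; that is, there exist positive constants c, C such that c · t² log t ≤ |R_2(t)| ≤ C · t² log t for all sufficiently large t. -/
open Polynomial

/-- The height of an integer polynomial: the maximum of the absolute values
of its coefficients. -/
def polyHeight (p : Polynomial ℤ) : ℕ :=
  p.support.sup fun i => (p.coeff i).natAbs

/-- `Rset n t` is the set of integer polynomials of degree exactly `n`,
height at most `t`, which are reducible over `ℚ`. -/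
def Rset (n : ℕ) (t : ℝ) : Set (Polynomial ℤ) :=
  {p | p.natDegree = n ∧ (polyHeight p : ℝ) ≤ t ∧
       ¬ Irreducible (p.map (Int.castRingHom ℚ))}

theorem polyHeight_le_iff {p : ℤ[X]} {t : ℝ} (ht : 0 ≤ t) :
    (polyHeight p : ℝ) ≤ t ↔ ∀ i, |(p.coeff i : ℝ)| ≤ t := by
  rw [← Nat.le_floor_iff ht, polyHeight, Finset.sup_le_iff]
  refine ⟨fun h i => ?_, fun h i _ => ?_⟩
  · by_cases hi : p.coeff i = 0
    · simpa [hi] using ht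
    · have := h i (mem_support_iff.2 hi)
      rwa [Nat.le_floor_iff ht, Nat.cast_natAbs, Int.cast_abs] at this
  · rw [Nat.le_floor_iff ht, Nat.cast_natAbs, Int.cast_abs]
    exact h i

/-- The product of the linear polynomials with coefficient pairs `x.1` and `x.2`. -/
noncomputable def linearProduct (x : (ℤ × ℤ) × (ℤ × ℤ)) : ℤ[X] :=
  (C x.1.1 * X + C x.1.2) * (C x.2.1 * X + C x.2.2)

theorem linearProduct_eq (a b c d : ℤ) :
    linearProduct ((a, b), (c, d)) = C (a * c) * X ^ 2 + C (a * d + b * c) * X + C (b * d) := by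
  simp only [linearProduct, C_mul, C_add]
  ring

theorem linearProduct_coeff_zero (a b c d : ℤ) :
    (linearProduct ((a, b), (c, d))).coeff 0 = b * d := by
  simp [linearProduct_eq, coeff_X]

theorem linearProduct_coeff_one (a b c d : ℤ) :
    (linearProduct ((a, b), (c, d))).coeff 1 = a * d + b * c := by
  rw [linearProduct_eq]
  simp only [coeff_add, coeff_C_mul, coeff_X_pow, coeff_X, coeff_C]
  norm_num

theorem linearProduct_coeff_two (a b c d : ℤ) :
    (linearProduct ((a, b), (c, d))).coeff 2 = a * c := by
  rw [linearProduct_eq]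
  simp only [coeff_add, coeff_C_mul, coeff_X_pow, coeff_X, coeff_C]
  norm_num

theorem natDegree_linearProduct {a b c d : ℤ} (ha : a ≠ 0) (hc : c ≠ 0) :
    (linearProduct ((a, b), (c, d))).natDegree = 2 := by
  rw [linearProduct_eq]
  exact natDegree_quadratic (mul_ne_zero ha hc)

theorem not_irreducible_map_linearProduct {a b c d : ℤ} (ha : a ≠ 0) (hc : c ≠ 0) :
    ¬ Irreducible ((linearProduct ((a, b), (c, d))).map (Int.castRingHom ℚ)) := by
  have key : ∀ u v : ℤ, u ≠ 0 →
      ¬ IsUnit ((C u * X + C v : ℤ[X]).map (Int.castRingHom ℚ)) := fun u v hu h => by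
    have h1 := natDegree_eq_zero_of_isUnit h
    rw [natDegree_map_eq_of_injective (RingHom.injective_int _), natDegree_linear hu] at h1
    exact one_ne_zero h1
  intro h
  rw [linearProduct, Polynomial.map_mul] at h
  exact (h.isUnit_or_isUnit rfl).elim (key _ _ ha) (key _ _ hc)

/-- Gauss's lemma for quadratics: a factorization over `ℚ` descends to `ℤ`. -/
theorem exists_linearProduct_of_not_irreducible {p : ℤ[X]} (hdeg : p.natDegree = 2)
    (hp : ¬ Irreducible (p.map (Int.castRingHom ℚ))) :
    ∃ a b c d : ℤ, a ≠ 0 ∧ c ≠ 0 ∧ linearProduct ((a, b), (c, d)) = p := by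
  have hdeg' : (p.map (Int.castRingHom ℚ)).natDegree = 2 := by
    rw [natDegree_map_eq_of_injective (RingHom.injective_int _), hdeg]
  rw [irreducible_iff_roots_eq_zero_of_degree_le_three (by omega) (by omega)] at hp
  obtain ⟨r, hr⟩ := Multiset.exists_mem_of_ne_zero hp
  have hdvd := dvd_iff_isRoot.2 (isRoot_of_mem_roots hr)
  have hden : (r.den : ℚ) ≠ 0 := by exact_mod_cast r.den_nz
  have hprim : (C (r.den : ℤ) * X + C (-r.num) : ℤ[X]).IsPrimitive := by
    intro z hz
    rw [C_dvd_iff_dvd_coeff] at hz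
    have h0 : z ∣ r.num := by simpa [-map_neg] using hz 0
    have h1 : z ∣ (r.den : ℤ) := by
      simpa only [coeff_add, coeff_C_mul, coeff_X_one, coeff_C_of_ne_zero one_ne_zero, mul_one,
        add_zero] using hz 1
    have hcop : IsCoprime r.num (r.den : ℤ) := Int.isCoprime_iff_gcd_eq_one.2 r.reduced
    exact hcop.isUnit_of_dvd' h0 h1
  have hmap : (C (r.den : ℤ) * X + C (-r.num) : ℤ[X]).map (Int.castRingHom ℚ)
      = C (r.den : ℚ) * (X - C r) := by
    have : (r.num : ℚ) = r.den * r := (Rat.den_mul_eq_num r).symm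
    rw [Polynomial.map_add, Polynomial.map_mul, map_C, map_C, map_X, eq_intCast, eq_intCast,
      Int.cast_neg, Int.cast_natCast, this, C_neg, C_mul]
    ring
  have hd : (C (r.den : ℤ) * X + C (-r.num) : ℤ[X]) ∣ p := by
    rw [IsPrimitive.Int.dvd_iff_map_cast_dvd_map_cast _ _ hprim, hmap]
    exact (IsUnit.mul_left_dvd (isUnit_C.2 hden.isUnit)).2 hdvd
  obtain ⟨q, rfl⟩ := hd
  have hden' : (r.den : ℤ) ≠ 0 := by exact_mod_cast r.den_nz
  have hq0 : q ≠ 0 := by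
    rintro rfl
    simp at hdeg
  rw [natDegree_mul hprim.ne_zero hq0, natDegree_linear hden'] at hdeg
  obtain ⟨c, hc, d, rfl⟩ := natDegree_eq_one.1 (show q.natDegree = 1 by omega)
  exact ⟨r.den, -r.num, c, d, hden', hc, rfl⟩

theorem abs_cross_mul_le {a b c d t : ℝ} (hac : |a * c| ≤ t) (hbd : |b * d| ≤ t)
    (h : |a * d + b * c| ≤ t) : |a| * |d| ≤ 2 * t := by
  by_contra! hlt
  have ht : 0 ≤ t := (abs_nonneg _).trans hac
  have h1 : |a * d| ≤ t + |b * c| := by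
    calc |a * d| = |(a * d + b * c) - b * c| := by ring_nf
      _ ≤ |a * d + b * c| + |b * c| := abs_sub _ _
      _ ≤ _ := by gcongr
  have h2 : |a * d| * |b * c| ≤ t * t := by
    calc |a * d| * |b * c| = |a * c| * |b * d| := by simp only [abs_mul]; ring
      _ ≤ t * t := by gcongr
  rw [← abs_mul] at hlt
  nlinarith [abs_nonneg (b * c)]

/-- The product of the heights of two linear polynomials is at most twice that of their product. -/
theorem max_mul_max_le {a b c d t : ℝ} (hac : |a * c| ≤ t) (hbd : |b * d| ≤ t)
    (h : |a * d + b * c| ≤ t) : max |a| |b| * max |c| |d| ≤ 2 * t := by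
  have ht : 0 ≤ t := (abs_nonneg _).trans hac
  have h1 := abs_cross_mul_le hac hbd h
  have h2 : |b| * |c| ≤ 2 * t := abs_cross_mul_le hbd hac (by rwa [add_comm])
  rw [abs_mul] at hac hbd
  rcases max_choice |a| |b| with h' | h' <;> rcases max_choice |c| |d| with h'' | h'' <;>
    rw [h', h''] <;> linarith

/-- Coefficient pairs of linear factors, the first factor having height `h` and the second
height at most `2t/h`. -/
noncomputable def factorPairs (t : ℝ) (h : ℕ) : Finset ((ℤ × ℤ) × (ℤ × ℤ)) :=
  Finset.box h ×ˢ (Finset.Icc (-(⌊2 * t / h⌋₊ : ℤ)) ⌊2 * t / h⌋₊ ×ˢ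
    Finset.Icc (-(⌊2 * t / h⌋₊ : ℤ)) ⌊2 * t / h⌋₊)

theorem card_factorPairs_le {t : ℝ} {h : ℕ} (hh : 1 ≤ h) (ht : h ≤ 2 * t) :
    ((factorPairs t h).card : ℝ) ≤ 288 * t ^ 2 * (h : ℝ)⁻¹ := by
  have hpos : (0 : ℝ) < h := by exact_mod_cast hh
  have h1 : 1 ≤ 2 * t / h := by rwa [le_div_iff₀ hpos, one_mul]
  have hfl : (⌊2 * t / h⌋₊ : ℝ) ≤ 2 * t / h := Nat.floor_le (by linarith)
  have hIcc : ∀ m : ℕ, (Finset.Icc (-(m : ℤ)) m).card = 2 * m + 1 := fun m => by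
    rw [Int.card_Icc]; omega
  rw [factorPairs, Finset.card_product, Finset.card_product, Int.card_box (by omega), hIcc]
  push_cast
  calc (8 * h : ℝ) * ((2 * ⌊2 * t / h⌋₊ + 1) * (2 * ⌊2 * t / h⌋₊ + 1))
      ≤ 8 * h * ((3 * (2 * t / h)) * (3 * (2 * t / h))) := by
        gcongr <;> linarith
    _ = _ := by field_simp; ring

theorem Rset_two_subset {t : ℝ} (ht : 0 ≤ t) :
    Rset 2 t ⊆ ((Finset.Icc 1 ⌊2 * t⌋₊).biUnion fun h =>
      (factorPairs t h).image linearProduct : Finset ℤ[X]) := by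
  rintro p ⟨hdeg, hht, hirr⟩
  obtain ⟨a, b, c, d, ha, hc, rfl⟩ := exists_linearProduct_of_not_irreducible hdeg hirr
  rw [polyHeight_le_iff ht] at hht
  have h0 := hht 0
  have h1 := hht 1
  have h2 := hht 2
  rw [linearProduct_coeff_zero] at h0
  rw [linearProduct_coeff_one] at h1
  rw [linearProduct_coeff_two] at h2
  push_cast at h0 h1 h2
  have hm := max_mul_max_le h2 h0 h1
  have hc1 : (1 : ℝ) ≤ |(c : ℝ)| := by exact_mod_cast Int.one_le_abs hc
  have hf : ((max a.natAbs b.natAbs : ℕ) : ℝ) = max |(a : ℝ)| |(b : ℝ)| := by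
    simp [Nat.cast_natAbs]
  have hf1 : 1 ≤ max a.natAbs b.natAbs := by omega
  have hfpos : (0 : ℝ) < (max a.natAbs b.natAbs : ℕ) := by exact_mod_cast hf1
  rw [← hf] at hm
  have hg : max |(c : ℝ)| |(d : ℝ)| ≤ 2 * t / (max a.natAbs b.natAbs : ℕ) := by
    rw [le_div_iff₀ hfpos]; linarith
  have hle : ∀ z : ℤ, |(z : ℝ)| ≤ max |(c : ℝ)| |(d : ℝ)| →
      z ∈ Finset.Icc (-(⌊2 * t / (max a.natAbs b.natAbs : ℕ)⌋₊ : ℤ))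
        ⌊2 * t / (max a.natAbs b.natAbs : ℕ)⌋₊ := fun z hz => by
    have : z.natAbs ≤ ⌊2 * t / (max a.natAbs b.natAbs : ℕ)⌋₊ := by
      apply Nat.le_floor
      rw [Nat.cast_natAbs, Int.cast_abs]
      exact hz.trans hg
    rw [Finset.mem_Icc]
    omega
  simp only [Finset.coe_biUnion, Set.mem_iUnion, Finset.coe_image]
  refine ⟨max a.natAbs b.natAbs, Finset.mem_coe.2 (Finset.mem_Icc.2 ⟨hf1, Nat.le_floor ?_⟩),
    ((a, b), (c, d)), ?_, rfl⟩
  · calc ((max a.natAbs b.natAbs : ℕ) : ℝ)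
        ≤ (max a.natAbs b.natAbs : ℕ) * max |(c : ℝ)| |(d : ℝ)| :=
          le_mul_of_one_le_right hfpos.le (hc1.trans (le_max_left _ _))
      _ ≤ 2 * t := hm
  · rw [Finset.mem_coe, factorPairs, Finset.mem_product, Finset.mem_product, Int.mem_box]
    exact ⟨rfl, hle c (le_max_left _ _), hle d (le_max_right _ _)⟩

theorem finite_Rset_two {t : ℝ} (ht : 0 ≤ t) : (Rset 2 t).Finite :=
  (Finset.finite_toSet _).subset (Rset_two_subset ht)

theorem ncard_Rset_two_le {t : ℝ} (ht : 1 ≤ t) :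
    ((Rset 2 t).ncard : ℝ) ≤ 288 * t ^ 2 * (1 + Real.log (2 * t)) := by
  have ht0 : 0 ≤ t := by linarith
  have h1 : (Rset 2 t).ncard ≤ ∑ h ∈ Finset.Icc 1 ⌊2 * t⌋₊, (factorPairs t h).card := by
    refine (Set.ncard_le_ncard (Rset_two_subset ht0) (Finset.finite_toSet _)).trans ?_
    rw [Set.ncard_coe_finset]
    exact Finset.card_biUnion_le.trans (Finset.sum_le_sum fun h _ => Finset.card_image_le)
  have h2 := harmonic_le_one_add_log ⌊2 * t⌋₊
  rw [harmonic_eq_sum_Icc] at h2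
  push_cast at h2
  calc ((Rset 2 t).ncard : ℝ) ≤ ∑ h ∈ Finset.Icc 1 ⌊2 * t⌋₊, ((factorPairs t h).card : ℝ) := by
        exact_mod_cast h1
    _ ≤ ∑ h ∈ Finset.Icc 1 ⌊2 * t⌋₊, 288 * t ^ 2 * (h : ℝ)⁻¹ := by
        refine Finset.sum_le_sum fun h hh => ?_
        rw [Finset.mem_Icc, Nat.le_floor_iff (by linarith)] at hh
        exact card_factorPairs_le hh.1 hh.2
    _ = 288 * t ^ 2 * ∑ h ∈ Finset.Icc 1 ⌊2 * t⌋₊, (h : ℝ)⁻¹ := by rw [Finset.mul_sum]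
    _ ≤ 288 * t ^ 2 * (1 + Real.log (2 * t)) := by
        have hfl : (1 : ℝ) ≤ ⌊2 * t⌋₊ := by
          exact_mod_cast Nat.le_floor (show ((1 : ℕ) : ℝ) ≤ 2 * t by push_cast; linarith)
        gcongr
        refine h2.trans ?_
        gcongr
        exact Nat.floor_le (by linarith)

theorem sum_inv_le_two_mul_sum_totient_div_sq (N : ℕ) :
    ∑ n ∈ Finset.Ioc 0 N, (n : ℝ)⁻¹ ≤
      2 * ∑ d ∈ Finset.Ioc 0 N, (d.totient : ℝ) * ((d : ℝ) ^ 2)⁻¹ := by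
  have hsq : ∑ e ∈ Finset.Ioc 0 N, ((e : ℝ) ^ 2)⁻¹ ≤ 2 := by
    have := sum_Ioo_inv_sq_le (α := ℝ) 0 (N + 1)
    rw [show Finset.Ioo 0 (N + 1) = Finset.Ioc 0 N by ext; simp] at this
    simpa using this
  have hterm : ∀ n ∈ Finset.Ioc 0 N, (n : ℝ)⁻¹ =
      ∑ x ∈ Finset.Ioc 0 N ×ˢ Finset.Ioc 0 N with x.1 * x.2 = n,
        ((x.1.totient : ℝ) * ((x.1 : ℝ) ^ 2)⁻¹) * ((x.2 : ℝ) ^ 2)⁻¹ := fun n hn => by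
    rw [Finset.mem_Ioc] at hn
    have hn0 : (n : ℝ) ≠ 0 := by exact_mod_cast hn.1.ne'
    rw [← Nat.divisorsAntidiagonal_eq_prod_filter_of_le hn.1.ne' hn.2]
    have : ∀ x ∈ n.divisorsAntidiagonal,
        ((x.1.totient : ℝ) * ((x.1 : ℝ) ^ 2)⁻¹) * ((x.2 : ℝ) ^ 2)⁻¹
          = (x.1.totient : ℝ) * ((n : ℝ) ^ 2)⁻¹ := fun x hx => by
      rw [← (Nat.mem_divisorsAntidiagonal.1 hx).1]
      push_cast
      rw [mul_pow, mul_inv, mul_assoc]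
    rw [Finset.sum_congr rfl this, ← Finset.sum_mul,
      Nat.sum_divisorsAntidiagonal (fun d _ => (d.totient : ℝ))]
    have htot : ∑ d ∈ n.divisors, (d.totient : ℝ) = n := by exact_mod_cast n.sum_totient
    rw [htot]
    field_simp
  rw [Finset.sum_congr rfl hterm, Finset.sum_fiberwise_eq_sum_filter]
  calc _ ≤ ∑ x ∈ Finset.Ioc 0 N ×ˢ Finset.Ioc 0 N,
        ((x.1.totient : ℝ) * ((x.1 : ℝ) ^ 2)⁻¹) * ((x.2 : ℝ) ^ 2)⁻¹ :=
        Finset.sum_le_sum_of_subset_of_nonneg (Finset.filter_subset _ _)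
          fun _ _ _ => by positivity
    _ = (∑ d ∈ Finset.Ioc 0 N, (d.totient : ℝ) * ((d : ℝ) ^ 2)⁻¹) *
          ∑ e ∈ Finset.Ioc 0 N, ((e : ℝ) ^ 2)⁻¹ := by
        rw [Finset.sum_mul_sum, Finset.sum_product]
    _ ≤ _ := by
        rw [mul_comm]
        gcongr

/-- Quadruples `(a, b, c, e)` for which `(aX + b)(cX + (c + e))` has height at most `t`, where
`b < a` are coprime. -/
noncomputable def coprimeFactors (t : ℝ) : Finset (Σ _ : ℕ, ℕ × (ℕ × ℕ)) :=
  (Finset.Ioc 0 ⌊t / 3⌋₊).sigma fun a => {b ∈ Finset.range a | a.Coprime b} ×ˢ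
    (Finset.Ioc 0 ⌊t / (3 * a)⌋₊ ×ˢ Finset.Ioc 0 ⌊t / (3 * a)⌋₊)

/-- The polynomial `(aX + b)(cX + (c + e))`. -/
noncomputable def coprimeProduct (x : Σ _ : ℕ, ℕ × (ℕ × ℕ)) : ℤ[X] :=
  linearProduct (((x.1 : ℤ), (x.2.1 : ℤ)), ((x.2.2.1 : ℤ), (x.2.2.1 + x.2.2.2 : ℤ)))

theorem coprimeProduct_mem_Rset {t : ℝ} (ht : 0 ≤ t) {x : Σ _ : ℕ, ℕ × (ℕ × ℕ)}
    (hx : x ∈ coprimeFactors t) : coprimeProduct x ∈ Rset 2 t := by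
  obtain ⟨a, b, c, e⟩ := x
  simp only [coprimeFactors, Finset.mem_sigma, Finset.mem_product, Finset.mem_filter,
    Finset.mem_range, Finset.mem_Ioc] at hx
  obtain ⟨⟨ha, -⟩, ⟨hb, -⟩, ⟨hc, hcM⟩, he, heM⟩ := hx
  have ha' : (a : ℤ) ≠ 0 := by exact_mod_cast ha.ne'
  have hc' : (c : ℤ) ≠ 0 := by exact_mod_cast hc.ne'
  have haR : (0 : ℝ) < a := by exact_mod_cast ha
  have hbR : (b : ℝ) ≤ a := by exact_mod_cast hb.le
  rw [Nat.le_floor_iff (by positivity), le_div_iff₀ (by positivity)] at hcM heM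
  have h1 : (a : ℝ) * c ≤ t / 3 := by linarith
  have h2 : (a : ℝ) * e ≤ t / 3 := by linarith
  have h3 : (b : ℝ) * c ≤ a * c := by gcongr
  have h4 : (b : ℝ) * e ≤ a * e := by gcongr
  refine ⟨natDegree_linearProduct ha' hc', (polyHeight_le_iff ht).2 fun i => ?_,
    not_irreducible_map_linearProduct ha' hc'⟩
  match i with
  | 0 =>
    rw [coprimeProduct, linearProduct_coeff_zero]
    push_cast
    rw [abs_of_nonneg (by positivity)]
    linarith
  | 1 =>
    rw [coprimeProduct, linearProduct_coeff_one]
    push_cast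
    rw [abs_of_nonneg (by positivity)]
    linarith
  | 2 =>
    rw [coprimeProduct, linearProduct_coeff_two]
    push_cast
    rw [abs_of_nonneg (by positivity)]
    linarith
  | i + 3 =>
    rw [coeff_eq_zero_of_natDegree_lt]
    · simpa using ht
    · rw [coprimeProduct, natDegree_linearProduct ha' hc']
      omega

theorem injOn_coprimeProduct (t : ℝ) :
    Set.InjOn coprimeProduct (coprimeFactors t : Set (Σ _ : ℕ, ℕ × (ℕ × ℕ))) := by
  rintro ⟨a, b, c, e⟩ hx ⟨a', b', c', e'⟩ hy hxy
  simp only [coprimeFactors, Finset.mem_coe, Finset.mem_sigma, Finset.mem_product,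
    Finset.mem_filter, Finset.mem_range, Finset.mem_Ioc] at hx hy
  obtain ⟨⟨ha, -⟩, ⟨hb, hab⟩, ⟨hc, -⟩, he, -⟩ := hx
  obtain ⟨⟨ha', -⟩, ⟨hb', hab'⟩, ⟨hc', -⟩, he', -⟩ := hy
  have h0 := congrArg (coeff · 0) hxy
  have h1 := congrArg (coeff · 1) hxy
  have h2 := congrArg (coeff · 2) hxy
  simp only [coprimeProduct, linearProduct_coeff_zero] at h0
  simp only [coprimeProduct, linearProduct_coeff_one] at h1
  simp only [coprimeProduct, linearProduct_coeff_two] at h2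
  have hroot : ((a' : ℤ) * b - a * b') * (a * (c' + e') - b * c') = 0 := by
    linear_combination (a : ℤ) ^ 2 * h0 - (a : ℤ) * b * h1 + (b : ℤ) ^ 2 * h2
  have hpos : (0 : ℤ) < a * (c' + e') - b * c' := by
    have : b * c' ≤ a * c' := Nat.mul_le_mul_right _ hb.le
    have : 0 < a * e' := Nat.mul_pos ha he'
    zify at *
    linarith
  have hcross : a' * b = a * b' := by
    have := (mul_eq_zero.1 hroot).resolve_right hpos.ne'
    zify
    linarith
  obtain rfl : a = a' := Nat.dvd_antisymm
    (hab.dvd_of_dvd_mul_right (Dvd.intro _ hcross.symm))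
    (hab'.dvd_of_dvd_mul_right (Dvd.intro _ hcross))
  obtain rfl : b = b' := Nat.eq_of_mul_eq_mul_left ha hcross
  have haZ : (a : ℤ) ≠ 0 := by exact_mod_cast ha.ne'
  have hcc : (c : ℤ) = c' := mul_left_cancel₀ haZ h2
  have hee : (e : ℤ) = e' := by
    rw [hcc] at h1
    have : (a : ℤ) * e = a * e' := by linarith
    exact mul_left_cancel₀ haZ this
  norm_cast at hcc hee
  rw [hcc, hee]

theorem le_card_coprimeFactors {t : ℝ} (ht : 0 < t) :
    t ^ 2 / 72 * Real.log (t / 3) ≤ ((coprimeFactors t).card : ℝ) := by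
  have hlog : Real.log (t / 3) ≤ ∑ n ∈ Finset.Ioc 0 ⌊t / 3⌋₊, (n : ℝ)⁻¹ := by
    have := log_le_harmonic_floor (t / 3) (by positivity)
    rw [harmonic_eq_sum_Icc] at this
    push_cast at this
    exact this
  have hcard : (coprimeFactors t).card = ∑ a ∈ Finset.Ioc 0 ⌊t / 3⌋₊,
      a.totient * (⌊t / (3 * a)⌋₊ * ⌊t / (3 * a)⌋₊) := by
    simp [coprimeFactors, Finset.card_sigma, Finset.card_product, Nat.totient_eq_card_coprime]
  have hfloor : ∀ a ∈ Finset.Ioc 0 ⌊t / 3⌋₊, t / (6 * a) ≤ (⌊t / (3 * a)⌋₊ : ℝ) := fun a ha => by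
    rw [Finset.mem_Ioc, Nat.le_floor_iff (by positivity)] at ha
    have haR : (0 : ℝ) < a := by exact_mod_cast ha.1
    have h1 : 1 ≤ t / (3 * a) := by
      rw [le_div_iff₀ (by positivity)]
      linarith [ha.2]
    have h2 : (1 : ℝ) ≤ ⌊t / (3 * a)⌋₊ := by
      exact_mod_cast Nat.le_floor (by exact_mod_cast h1)
    have h3 := Nat.lt_floor_add_one (t / (3 * a))
    have h4 : t / (3 * a) = 2 * (t / (6 * a)) := by field_simp; norm_num
    linarith
  calc t ^ 2 / 72 * Real.log (t / 3)
      ≤ t ^ 2 / 72 * (2 * ∑ d ∈ Finset.Ioc 0 ⌊t / 3⌋₊,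
          (d.totient : ℝ) * ((d : ℝ) ^ 2)⁻¹) := by
        gcongr
        exact hlog.trans (sum_inv_le_two_mul_sum_totient_div_sq _)
    _ = ∑ a ∈ Finset.Ioc 0 ⌊t / 3⌋₊, (a.totient : ℝ) * (t / (6 * a) * (t / (6 * a))) := by
        rw [Finset.mul_sum, Finset.mul_sum]
        refine Finset.sum_congr rfl fun a ha => ?_
        have haR : (a : ℝ) ≠ 0 := by exact_mod_cast (Finset.mem_Ioc.1 ha).1.ne'
        field_simp
        ring
    _ ≤ ∑ a ∈ Finset.Ioc 0 ⌊t / 3⌋₊,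
          (a.totient : ℝ) * (⌊t / (3 * a)⌋₊ * ⌊t / (3 * a)⌋₊) := by
        refine Finset.sum_le_sum fun a ha => ?_
        have := hfloor a ha
        gcongr
    _ = ((coprimeFactors t).card : ℝ) := by
        rw [hcard]
        push_cast
        rfl

theorem le_ncard_Rset_two {t : ℝ} (ht : 0 < t) :
    t ^ 2 / 72 * Real.log (t / 3) ≤ ((Rset 2 t).ncard : ℝ) := by
  refine (le_card_coprimeFactors ht).trans ?_
  rw [← Finset.card_image_of_injOn (injOn_coprimeProduct t), ← Set.ncard_coe_finset]
  refine Nat.cast_le.2 (Set.ncard_le_ncard ?_ (finite_Rset_two ht.le))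
  intro p hp
  rw [Finset.coe_image] at hp
  obtain ⟨x, hx, rfl⟩ := hp
  exact coprimeProduct_mem_Rset ht.le hx

/-- As `t → ∞`, `t² log t ≪ |R_2(t)| ≪ t² log t`. -/
theorem stmt1 :
    ∃ c C : ℝ, 0 < c ∧ 0 < C ∧ ∃ t₀ : ℝ, ∀ t : ℝ, t₀ ≤ t →
      c * t ^ 2 * Real.log t ≤ ((Rset 2 t).ncard : ℝ) ∧
      ((Rset 2 t).ncard : ℝ) ≤ C * t ^ 2 * Real.log t := by
  refine ⟨1 / 144, 864, by norm_num, by norm_num, 9, fun t ht => ⟨?_, ?_⟩⟩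
  · have h3 : 2 * Real.log 3 ≤ Real.log t := by
      rw [← Real.log_rpow (by norm_num)]
      exact Real.log_le_log (by positivity) (by norm_num; linarith)
    have h := le_ncard_Rset_two (t := t) (by linarith)
    rw [Real.log_div (by linarith) (by norm_num)] at h
    refine le_trans ?_ h
    nlinarith [sq_nonneg t]
  · have h2 : Real.log 2 ≤ Real.log t := Real.log_le_log (by norm_num) (by linarith)
    have h1 : 1 ≤ Real.log t := by
      rw [Real.le_log_iff_exp_le (by linarith)]
      linarith [Real.exp_one_lt_d9]
    have h := ncard_Rset_two_le (t := t) (by linarith)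
    rw [Real.log_mul (by norm_num) (by linarith)] at h
    refine h.trans ?_
    nlinarith [sq_nonneg t]
end

section
/- For n = 3, as t → ∞ one has t²(log t)² ≪ |R_3(t) \ R_{2,3}(t)| ≪ t²(log t)²; in particular, the factor (log t)² in the bound |R_n(t) \ R_{n-1,n}(t)| ≪ t^{n-1}(log t)² cannot be omitted when n = 3. -/
open Polynomial

/-- `Rkn k n t` is the subset of `Rset n t` of polynomials having an
irreducible factor in `ℤ[X]` of degree exactly `k`. -/
def Rkn (k n : ℕ) (t : ℝ) : Set (Polynomial ℤ) :=
  {p ∈ Rset n t | ∃ g : Polynomial ℤ, Irreducible g ∧ g.natDegree = k ∧ g ∣ p}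

/-- The integer linear form `v.1 * X + v.2`. -/
noncomputable def linForm (v : ℤ × ℤ) : ℤ[X] := C v.1 * X + C v.2

/-- The product of three integer linear forms. -/
noncomputable def linProd (x : (ℤ × ℤ) × (ℤ × ℤ) × (ℤ × ℤ)) : ℤ[X] :=
  linForm x.1 * linForm x.2.1 * linForm x.2.2

lemma natDegree_linForm {v : ℤ × ℤ} (h : v.1 ≠ 0) : (linForm v).natDegree = 1 :=
  natDegree_linear h

lemma linForm_ne_zero {v : ℤ × ℤ} (h : v.1 ≠ 0) : linForm v ≠ 0 :=
  ne_zero_of_natDegree_gt (n := 0) (by simp [natDegree_linForm h])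

lemma exists_linForm_eq {p : ℤ[X]} (h : p.natDegree = 1) : ∃ v : ℤ × ℤ, v.1 ≠ 0 ∧ p = linForm v := by
  obtain ⟨a, ha, b, hab⟩ := natDegree_eq_one.mp h
  exact ⟨(a, b), ha, hab.symm⟩

lemma exists_linForm_dvd {q : ℤ[X]} (h2 : 2 ≤ q.natDegree) (h3 : q.natDegree ≤ 3)
    (hq : ¬ Irreducible (q.map (Int.castRingHom ℚ))) :
    ∃ v : ℤ × ℤ, v.1 ≠ 0 ∧ linForm v ∣ q := by
  have hdeg : (q.map (Int.castRingHom ℚ)).natDegree = q.natDegree :=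
    natDegree_map_eq_of_injective (RingHom.injective_int _) q
  have hr : ∃ r, (q.map (Int.castRingHom ℚ)).IsRoot r := by
    by_contra! h
    exact hq (irreducible_of_degree_le_three_of_not_isRoot (by rw [hdeg, Finset.mem_Icc]; omega) h)
  obtain ⟨r, hr⟩ := hr
  have hden : (r.den : ℤ) ≠ 0 := by exact_mod_cast r.den_nz
  refine ⟨(r.den, -r.num), hden, ?_⟩
  have hprim : (linForm (r.den, -r.num)).IsPrimitive := by
    intro c hc
    rw [C_dvd_iff_dvd_coeff] at hc
    have h0 := hc 0
    have h1 := hc 1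
    simp only [linForm, coeff_add, coeff_C_mul, coeff_X_zero, coeff_X_one, coeff_C,
      mul_zero, mul_one, zero_add, one_ne_zero, if_true, if_false, add_zero, dvd_neg] at h0 h1
    have hcop : IsCoprime r.num (r.den : ℤ) := by
      rw [Int.isCoprime_iff_nat_coprime]
      simpa using r.reduced
    exact hcop.isUnit_of_dvd' h0 h1
  rw [IsPrimitive.Int.dvd_iff_map_cast_dvd_map_cast _ _ hprim]
  have hd : (r.den : ℚ) ≠ 0 := by exact_mod_cast r.den_nz
  have heq : (linForm (r.den, -r.num)).map (Int.castRingHom ℚ) = C (r.den : ℚ) * (X - C r) := by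
    have : (r.num : ℚ) = r.den * r := by rw [mul_comm, Rat.mul_den_eq_num]
    simp only [linForm, Polynomial.map_add, Polynomial.map_mul, map_X, map_C, mul_sub, ← C_mul]
    simp [← this, sub_eq_add_neg]
  rw [heq]
  exact (isUnit_C.mpr (isUnit_iff_ne_zero.mpr hd)).mul_left_dvd.mpr (dvd_iff_isRoot.mpr hr)

lemma exists_linForm_dvd_of_natDegree_two {q : ℤ[X]} (h2 : q.natDegree = 2)
    (hq : ∀ g : ℤ[X], Irreducible g → g.natDegree = 2 → ¬ g ∣ q) :
    ∃ v : ℤ × ℤ, v.1 ≠ 0 ∧ linForm v ∣ q := by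
  have hdeg : q.primPart.natDegree = 2 := by rw [natDegree_primPart, h2]
  have hirr : ¬ Irreducible (q.primPart.map (Int.castRingHom ℚ)) := by
    rw [← IsPrimitive.Int.irreducible_iff_irreducible_map_cast q.isPrimitive_primPart]
    exact fun h => hq _ h hdeg q.primPart_dvd
  obtain ⟨v, hv, hd⟩ := exists_linForm_dvd hdeg.ge (by omega) hirr
  exact ⟨v, hv, hd.trans q.primPart_dvd⟩

lemma exists_linProd_eq {t : ℝ} {p : ℤ[X]} (hp : p ∈ Rset 3 t \ Rkn 2 3 t) :
    ∃ x, x.1.1 ≠ 0 ∧ x.2.1.1 ≠ 0 ∧ x.2.2.1 ≠ 0 ∧ p = linProd x := by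
  obtain ⟨hR, hK⟩ := hp
  have hK' : ∀ g : ℤ[X], Irreducible g → g.natDegree = 2 → ¬ g ∣ p :=
    fun g h1 h2 h3 => hK ⟨hR, g, h1, h2, h3⟩
  obtain ⟨h3, -, hirr⟩ := hR
  obtain ⟨u, hu, q, rfl⟩ := exists_linForm_dvd (by omega) h3.le hirr
  have hq0 : q ≠ 0 := by rintro rfl; simp at h3
  rw [natDegree_mul (linForm_ne_zero hu) hq0, natDegree_linForm hu] at h3
  have hq2 : q.natDegree = 2 := by omega
  obtain ⟨v, hv, r, rfl⟩ := exists_linForm_dvd_of_natDegree_two hq2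
    fun g h1 h2 h => hK' g h1 h2 (h.mul_left _)
  have hr0 : r ≠ 0 := by rintro rfl; simp at hq2
  rw [natDegree_mul (linForm_ne_zero hv) hr0, natDegree_linForm hv] at hq2
  obtain ⟨w, hw, rfl⟩ := exists_linForm_eq (p := r) (by omega)
  exact ⟨(u, v, w), hu, hv, hw, by simp [linProd, mul_assoc]⟩

lemma natAbs_coeff_le_polyHeight (p : ℤ[X]) (i : ℕ) : (p.coeff i).natAbs ≤ polyHeight p := by
  by_cases h : i ∈ p.support
  · exact Finset.le_sup (f := fun i => (p.coeff i).natAbs) h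
  · simp [notMem_support_iff.mp h]

lemma mahlerMeasure_map_linForm {v : ℤ × ℤ} (h : v.1 ≠ 0) :
    ((linForm v).map (Int.castRingHom ℂ)).mahlerMeasure = (max v.1.natAbs v.2.natAbs : ℕ) := by
  have h' : (v.1 : ℂ) ≠ 0 := by exact_mod_cast h
  have := mahlerMeasure_C_mul_X_add_C h' v.2
  simp only [linForm, Polynomial.map_add, Polynomial.map_mul, map_X, eq_intCast,
    Nat.cast_max]
  simpa [Nat.cast_natAbs] using this

lemma prod_max_le_of_linProd {x : (ℤ × ℤ) × (ℤ × ℤ) × (ℤ × ℤ)} (h1 : x.1.1 ≠ 0)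
    (h2 : x.2.1.1 ≠ 0) (h3 : x.2.2.1 ≠ 0) :
    max x.1.1.natAbs x.1.2.natAbs * max x.2.1.1.natAbs x.2.1.2.natAbs *
      max x.2.2.1.natAbs x.2.2.2.natAbs ≤ 4 * polyHeight (linProd x) := by
  have hm := mahlerMeasure_le_sum_norm_coeff ((linProd x).map (Int.castRingHom ℂ))
  have hdeg : (linProd x).natDegree = 3 := by
    rw [linProd, natDegree_mul (mul_ne_zero (linForm_ne_zero h1) (linForm_ne_zero h2))
      (linForm_ne_zero h3), natDegree_mul (linForm_ne_zero h1) (linForm_ne_zero h2),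
      natDegree_linForm h1, natDegree_linForm h2, natDegree_linForm h3]
  have hsum : (((linProd x).map (Int.castRingHom ℂ)).sum fun _ a => ‖a‖) ≤
      4 * polyHeight (linProd x) := by
    rw [sum_over_range' _ (by simp) 4 (by
      rw [natDegree_map_eq_of_injective (RingHom.injective_int _), hdeg]; norm_num)]
    calc _ ≤ ∑ i ∈ Finset.range 4, (polyHeight (linProd x) : ℝ) := by
          refine Finset.sum_le_sum fun i _ => ?_
          have := natAbs_coeff_le_polyHeight (linProd x) i
          rw [coeff_map, eq_intCast, Complex.norm_intCast, ← Int.cast_abs, ← Nat.cast_natAbs]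
          exact_mod_cast this
      _ = _ := by simp
  have hprod : ((linProd x).map (Int.castRingHom ℂ)).mahlerMeasure =
      ((max x.1.1.natAbs x.1.2.natAbs : ℕ) : ℝ) * (max x.2.1.1.natAbs x.2.1.2.natAbs : ℕ) *
      (max x.2.2.1.natAbs x.2.2.2.natAbs : ℕ) := by
    rw [linProd, Polynomial.map_mul, Polynomial.map_mul, mahlerMeasure_mul, mahlerMeasure_mul,
      mahlerMeasure_map_linForm h1, mahlerMeasure_map_linForm h2, mahlerMeasure_map_linForm h3]
  have := (hprod ▸ hm).trans hsum
  exact_mod_cast this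

lemma card_filter_mul_mul_le (N : ℕ) :
    ((((Finset.Icc 1 N ×ˢ Finset.Icc 1 N) ×ˢ Finset.Icc 1 N).filter
      fun h => h.1.1 * h.1.2 * h.2 ≤ N).card : ℝ) ≤ N * (1 + Real.log N) ^ 2 := by
  have hle : (((Finset.Icc 1 N ×ˢ Finset.Icc 1 N) ×ˢ Finset.Icc 1 N).filter
      fun h => h.1.1 * h.1.2 * h.2 ≤ N).card ≤
      ∑ h ∈ Finset.Icc 1 N ×ˢ Finset.Icc 1 N, N / (h.1 * h.2) := by
    rw [Finset.card_filter, Finset.sum_product]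
    refine Finset.sum_le_sum fun h hh => ?_
    rw [← Finset.card_filter]
    simp only [Finset.mem_product, Finset.mem_Icc] at hh
    have hpos : 0 < h.1 * h.2 := Nat.mul_pos (by omega) (by omega)
    calc _ ≤ (Finset.Icc 1 (N / (h.1 * h.2))).card := by
          refine Finset.card_le_card fun k hk => ?_
          simp only [Finset.mem_filter, Finset.mem_Icc] at hk ⊢
          exact ⟨hk.1.1, (Nat.le_div_iff_mul_le hpos).mpr (by linarith [hk.2, mul_comm k (h.1 * h.2)])⟩
      _ = _ := by simp
  have hharm : (∑ i ∈ Finset.Icc 1 N, (i : ℝ)⁻¹) ≤ 1 + Real.log N := by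
    have := harmonic_le_one_add_log N
    rw [harmonic_eq_sum_Icc] at this
    push_cast at this
    exact this
  have hnn : 0 ≤ ∑ i ∈ Finset.Icc 1 N, (i : ℝ)⁻¹ := Finset.sum_nonneg fun i _ => by positivity
  calc _ ≤ ((∑ h ∈ Finset.Icc 1 N ×ˢ Finset.Icc 1 N, N / (h.1 * h.2) : ℕ) : ℝ) := by
        exact_mod_cast hle
    _ ≤ ∑ h ∈ Finset.Icc 1 N ×ˢ Finset.Icc 1 N, (N : ℝ) * ((h.1 : ℝ)⁻¹ * (h.2 : ℝ)⁻¹) := by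
        push_cast
        refine Finset.sum_le_sum fun h _ => ?_
        refine Nat.cast_div_le.trans (le_of_eq ?_)
        push_cast
        rw [div_eq_mul_inv, mul_inv]
    _ = N * (∑ i ∈ Finset.Icc 1 N, (i : ℝ)⁻¹) ^ 2 := by
        rw [← Finset.mul_sum, Finset.sum_product, sq, Finset.sum_mul_sum]
    _ ≤ _ := by gcongr

/-- Triples of nonzero integer vectors whose sup norms have product at most `N`. -/
noncomputable def smallTriples (N : ℕ) : Finset ((ℤ × ℤ) × (ℤ × ℤ) × (ℤ × ℤ)) :=
  (((Finset.Icc 1 N ×ˢ Finset.Icc 1 N) ×ˢ Finset.Icc 1 N).filter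
    fun h => h.1.1 * h.1.2 * h.2 ≤ N).biUnion
    fun h => Finset.box h.1.1 ×ˢ Finset.box h.1.2 ×ˢ Finset.box h.2

lemma card_smallTriples_le (N : ℕ) :
    ((smallTriples N).card : ℝ) ≤ 512 * N ^ 2 * (1 + Real.log N) ^ 2 := by
  have h : (smallTriples N).card ≤ (((Finset.Icc 1 N ×ˢ Finset.Icc 1 N) ×ˢ Finset.Icc 1 N).filter
    fun h => h.1.1 * h.1.2 * h.2 ≤ N).card * (512 * N) := by
    refine Finset.card_biUnion_le_card_mul _ _ _ fun h hh => ?_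
    simp only [Finset.mem_filter, Finset.mem_product, Finset.mem_Icc] at hh
    rw [Finset.card_product, Finset.card_product, Int.card_box (by omega), Int.card_box (by omega),
      Int.card_box (by omega)]
    linarith [hh.2]
  calc ((smallTriples N).card : ℝ) ≤ _ := Nat.cast_le.mpr h
    _ ≤ (N * (1 + Real.log N) ^ 2) * (512 * N) := by
        push_cast
        gcongr
        exact card_filter_mul_mul_le N
    _ = _ := by ring

lemma mem_smallTriples {N : ℕ} {x : (ℤ × ℤ) × (ℤ × ℤ) × (ℤ × ℤ)} (h1 : x.1.1 ≠ 0)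
    (h2 : x.2.1.1 ≠ 0) (h3 : x.2.2.1 ≠ 0)
    (h : max x.1.1.natAbs x.1.2.natAbs * max x.2.1.1.natAbs x.2.1.2.natAbs *
      max x.2.2.1.natAbs x.2.2.2.natAbs ≤ N) : x ∈ smallTriples N := by
  have p1 : 1 ≤ max x.1.1.natAbs x.1.2.natAbs := le_max_of_le_left (by omega)
  have p2 : 1 ≤ max x.2.1.1.natAbs x.2.1.2.natAbs := le_max_of_le_left (by omega)
  have p3 : 1 ≤ max x.2.2.1.natAbs x.2.2.2.natAbs := le_max_of_le_left (by omega)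
  simp only [smallTriples, Finset.mem_biUnion, Finset.mem_filter, Finset.mem_product,
    Finset.mem_Icc, Int.mem_box]
  refine ⟨((_, _), _), ⟨⟨⟨⟨p1, ?_⟩, p2, ?_⟩, p3, ?_⟩, h⟩, rfl, rfl, rfl⟩ <;> dsimp only <;>
    refine le_trans ?_ h
  · exact (Nat.le_mul_of_pos_right _ p2).trans (Nat.le_mul_of_pos_right _ p3)
  · exact (Nat.le_mul_of_pos_left _ p1).trans (Nat.le_mul_of_pos_right _ p3)
  · exact Nat.le_mul_of_pos_left _ (Nat.mul_pos p1 p2)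

open scoped Classical in
lemma diff_subset_image (t : ℝ) :
    Rset 3 t \ Rkn 2 3 t ⊆ ((smallTriples ⌊4 * t⌋₊).image linProd : Finset ℤ[X]) := by
  intro p hp
  obtain ⟨x, h1, h2, h3, rfl⟩ := exists_linProd_eq hp
  have hH : (polyHeight (linProd x) : ℝ) ≤ t := hp.1.2.1
  rw [Finset.mem_coe]
  refine Finset.mem_image_of_mem _ (mem_smallTriples h1 h2 h3 ?_)
  refine Nat.le_floor (le_trans (Nat.cast_le.mpr (prod_max_le_of_linProd h1 h2 h3)) ?_)
  push_cast
  linarith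

lemma finite_diff (t : ℝ) : (Rset 3 t \ Rkn 2 3 t).Finite := by
  classical exact (Finset.finite_toSet _).subset (diff_subset_image t)

lemma ncard_diff_le {t : ℝ} (ht : 4 ≤ t) :
    ((Rset 3 t \ Rkn 2 3 t).ncard : ℝ) ≤ 73728 * t ^ 2 * Real.log t ^ 2 := by
  classical
  have h1 : (Rset 3 t \ Rkn 2 3 t).ncard ≤ (smallTriples ⌊4 * t⌋₊).card := by
    refine (Set.ncard_le_ncard (diff_subset_image t) (Finset.finite_toSet _)).trans ?_
    rw [Set.ncard_coe_finset]
    exact Finset.card_image_le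
  have hN : (⌊4 * t⌋₊ : ℝ) ≤ 4 * t := Nat.floor_le (by linarith)
  have hN1 : (1 : ℝ) ≤ ⌊4 * t⌋₊ := by
    have : 1 ≤ ⌊4 * t⌋₊ := Nat.le_floor (by push_cast; linarith)
    exact_mod_cast this
  have hlog4 : Real.log 4 ≤ Real.log t := Real.log_le_log (by norm_num) ht
  have hlog1 : 1 ≤ Real.log t := by
    rw [Real.le_log_iff_exp_le (by linarith)]
    linarith [Real.exp_one_lt_d9]
  have hlogN : Real.log ⌊4 * t⌋₊ ≤ 2 * Real.log t := by
    refine (Real.log_le_log (by linarith) hN).trans ?_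
    rw [Real.log_mul (by norm_num) (by linarith)]
    linarith
  have hlogN0 : 0 ≤ Real.log ⌊4 * t⌋₊ := Real.log_nonneg hN1
  calc ((Rset 3 t \ Rkn 2 3 t).ncard : ℝ) ≤ (smallTriples ⌊4 * t⌋₊).card := by exact_mod_cast h1
    _ ≤ _ := card_smallTriples_le _
    _ ≤ 512 * (4 * t) ^ 2 * (3 * Real.log t) ^ 2 := by
        gcongr
        linarith
    _ = _ := by ring

/-- The pairs of coprime integers in `[1, N]`. -/
def coprimePairs (N : ℕ) : Finset (ℕ × ℕ) :=
  (Finset.Icc 1 N ×ˢ Finset.Icc 1 N).filter fun v => v.1.Coprime v.2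

lemma sum_inv_sq_le (N : ℕ) : ∑ d ∈ Finset.Icc 2 N, ((d : ℝ) ^ 2)⁻¹ ≤ 3 / 4 := by
  rcases lt_or_ge N 2 with h | h
  · rw [Finset.Icc_eq_empty (by omega), Finset.sum_empty]
    norm_num
  · have key : ∑ d ∈ Finset.Icc 2 N, ((d : ℝ) ^ 2)⁻¹ ≤ 3 / 4 - 1 / (N : ℝ) := by
      induction N, h using Nat.le_induction with
      | base => norm_num
      | succ n hn ih =>
        rw [Finset.sum_Icc_succ_top (by omega)]
        have hn0 : (0 : ℝ) < n := by exact_mod_cast (by omega : 0 < n)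
        have : (((n + 1 : ℕ) : ℝ) ^ 2)⁻¹ ≤ 1 / n - 1 / ((n + 1 : ℕ) : ℝ) := by
          push_cast
          rw [div_sub_div _ _ hn0.ne' (by positivity), inv_eq_one_div]
          have : (1 : ℝ) * (n + 1) - n * 1 = 1 := by ring
          rw [this]
          refine one_div_le_one_div_of_le (by positivity) ?_
          nlinarith
        linarith
    have : 0 ≤ 1 / (N : ℝ) := by positivity
    linarith

lemma card_filter_not_coprime_le (N : ℕ) :
    ((Finset.Icc 1 N ×ˢ Finset.Icc 1 N).filter fun v => ¬ v.1.Coprime v.2).card ≤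
      ∑ d ∈ Finset.Icc 2 N, (N / d) ^ 2 := by
  calc _ ≤ ((Finset.Icc 2 N).biUnion fun d =>
        (Finset.Icc 1 (N / d) ×ˢ Finset.Icc 1 (N / d)).image fun v => (d * v.1, d * v.2)).card := by
        refine Finset.card_le_card fun v hv => ?_
        simp only [Finset.mem_filter, Finset.mem_product, Finset.mem_Icc] at hv
        obtain ⟨⟨⟨h1, h1'⟩, h2, h2'⟩, hc⟩ := hv
        have hg : 0 < v.1.gcd v.2 := Nat.gcd_pos_of_pos_left _ h1
        have hg1 : v.1.gcd v.2 ≠ 1 := hc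
        simp only [Finset.mem_biUnion, Finset.mem_image, Finset.mem_product, Finset.mem_Icc]
        refine ⟨v.1.gcd v.2, ⟨by omega, (Nat.gcd_le_left _ h1).trans h1'⟩,
          (v.1 / v.1.gcd v.2, v.2 / v.1.gcd v.2), ⟨⟨?_, Nat.div_le_div_right h1'⟩, ?_,
            Nat.div_le_div_right h2'⟩, Prod.ext (Nat.mul_div_cancel' (Nat.gcd_dvd_left _ _))
              (Nat.mul_div_cancel' (Nat.gcd_dvd_right _ _))⟩
        · exact Nat.div_pos (Nat.gcd_le_left _ h1) hg
        · exact Nat.div_pos (Nat.gcd_le_right _ h2) hg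
    _ ≤ _ := by
        refine Finset.card_biUnion_le.trans (Finset.sum_le_sum fun d _ => ?_)
        refine Finset.card_image_le.trans (le_of_eq ?_)
        rw [Finset.card_product, Nat.card_Icc, Nat.add_sub_cancel, sq]

lemma sq_le_four_mul_card_coprimePairs (N : ℕ) : N ^ 2 ≤ 4 * (coprimePairs N).card := by
  have h1 := Finset.card_filter_add_card_filter_not (s := Finset.Icc 1 N ×ˢ Finset.Icc 1 N)
    fun v => v.1.Coprime v.2
  have h2 : ((∑ d ∈ Finset.Icc 2 N, (N / d) ^ 2 : ℕ) : ℝ) ≤ N ^ 2 * (3 / 4) := by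
    calc ((∑ d ∈ Finset.Icc 2 N, (N / d) ^ 2 : ℕ) : ℝ)
        ≤ ∑ d ∈ Finset.Icc 2 N, (N : ℝ) ^ 2 * ((d : ℝ) ^ 2)⁻¹ := by
          push_cast
          refine Finset.sum_le_sum fun d _ => ?_
          rw [← div_eq_mul_inv, ← div_pow]
          gcongr
          exact Nat.cast_div_le
      _ ≤ _ := by
          rw [← Finset.mul_sum]
          gcongr
          exact sum_inv_sq_le N
  have h3 := card_filter_not_coprime_le N
  rw [Finset.card_product, Nat.card_Icc, Nat.add_sub_cancel] at h1
  have h4 : N * N ≤ (coprimePairs N).card + ∑ d ∈ Finset.Icc 2 N, (N / d) ^ 2 := by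
    rw [coprimePairs]
    omega
  have h5 : (N : ℝ) * N ≤ (coprimePairs N).card + (∑ d ∈ Finset.Icc 2 N, (N / d) ^ 2 : ℕ) := by
    exact_mod_cast h4
  have h6 : (N : ℝ) ^ 2 ≤ 4 * (coprimePairs N).card := by nlinarith
  exact_mod_cast h6

/-- The coprime pairs in `[1, 4 ^ (i + 1)]` with maximum larger than `4 ^ i`. -/
def coprimeShell (i : ℕ) : Finset (ℕ × ℕ) :=
  (coprimePairs (4 ^ (i + 1))).filter fun v => 4 ^ i < max v.1 v.2

lemma mem_coprimeShell {i : ℕ} {v : ℕ × ℕ} : v ∈ coprimeShell i ↔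
    (((1 ≤ v.1 ∧ v.1 ≤ 4 ^ (i + 1)) ∧ 1 ≤ v.2 ∧ v.2 ≤ 4 ^ (i + 1)) ∧ v.1.Coprime v.2) ∧
      4 ^ i < max v.1 v.2 := by
  simp [coprimeShell, coprimePairs]

lemma pow_le_card_coprimeShell (i : ℕ) : 16 ^ i ≤ (coprimeShell i).card := by
  have h := sq_le_four_mul_card_coprimePairs (4 ^ (i + 1))
  have h2 : (coprimePairs (4 ^ (i + 1))).card ≤ (coprimeShell i).card + 16 ^ i := by
    rw [coprimeShell, ← Finset.card_filter_add_card_filter_not (s := coprimePairs (4 ^ (i + 1)))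
      fun v => 4 ^ i < max v.1 v.2]
    gcongr
    calc _ ≤ (Finset.Icc 1 (4 ^ i) ×ˢ Finset.Icc 1 (4 ^ i)).card := by
          refine Finset.card_le_card fun v hv => ?_
          simp only [coprimePairs, Finset.mem_filter, Finset.mem_product, Finset.mem_Icc, not_lt,
            max_le_iff] at hv ⊢
          exact ⟨⟨hv.1.1.1.1, hv.2.1⟩, hv.1.1.2.1, hv.2.2⟩
      _ = 16 ^ i := by
          rw [Finset.card_product, Nat.card_Icc, Nat.add_sub_cancel, ← mul_pow]
          norm_num
  have h3 : (4 ^ (i + 1)) ^ 2 = 16 * 16 ^ i := by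
    rw [← pow_mul, mul_comm, pow_mul, pow_succ]; ring
  omega

lemma eq_of_mem_coprimeShell {i j : ℕ} {v : ℕ × ℕ} (hi : v ∈ coprimeShell i)
    (hj : v ∈ coprimeShell j) : i = j := by
  rw [mem_coprimeShell] at hi hj
  have key : ∀ {a b : ℕ}, 4 ^ a < max v.1 v.2 → max v.1 v.2 ≤ 4 ^ (b + 1) → a ≤ b := by
    intro a b ha hb
    exact Nat.lt_succ_iff.mp ((Nat.pow_lt_pow_iff_right (by norm_num)).mp (ha.trans_le hb))
  exact le_antisymm (key hi.2 (max_le hj.1.1.1.2 hj.1.1.2.2))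
    (key hj.2 (max_le hi.1.1.1.2 hi.1.1.2.2))

/-- Triples of coprime pairs taken from shells whose indices add up to `2 * M`. -/
def shellTriples (M : ℕ) : Finset ((ℕ × ℕ) × (ℕ × ℕ) × (ℕ × ℕ)) :=
  (Finset.range M ×ˢ Finset.range M).biUnion fun h =>
    coprimeShell h.1 ×ˢ coprimeShell h.2 ×ˢ coprimeShell (2 * M - h.1 - h.2)

lemma le_card_shellTriples (M : ℕ) : M ^ 2 * 16 ^ (2 * M) ≤ (shellTriples M).card := by
  rw [shellTriples, Finset.card_biUnion]
  · calc M ^ 2 * 16 ^ (2 * M) = ∑ h ∈ Finset.range M ×ˢ Finset.range M, 16 ^ (2 * M) := by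
          simp [sq]
      _ ≤ _ := by
          refine Finset.sum_le_sum fun h hh => ?_
          simp only [Finset.mem_product, Finset.mem_range] at hh
          rw [Finset.card_product, Finset.card_product]
          calc 16 ^ (2 * M) = 16 ^ h.1 * (16 ^ h.2 * 16 ^ (2 * M - h.1 - h.2)) := by
                rw [← pow_add, ← pow_add]; congr 1; omega
            _ ≤ _ := by gcongr <;> exact pow_le_card_coprimeShell _
  · intro h _ h' _ hne
    refine Finset.disjoint_left.mpr fun x hx hx' => hne ?_
    simp only [Finset.mem_product] at hx hx'
    exact Prod.ext (eq_of_mem_coprimeShell hx.1 hx'.1) (eq_of_mem_coprimeShell hx.2.1 hx'.2.1)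

/-- The product of three linear forms with natural number coefficients. -/
noncomputable def natLinProd (x : (ℕ × ℕ) × (ℕ × ℕ) × (ℕ × ℕ)) : ℤ[X] :=
  linProd ((x.1.1, x.1.2), (x.2.1.1, x.2.1.2), (x.2.2.1, x.2.2.2))

lemma natLinProd_eq_toPoly (x : (ℕ × ℕ) × (ℕ × ℕ) × (ℕ × ℕ)) : natLinProd x =
    Cubic.toPoly (⟨x.1.1 * x.2.1.1 * x.2.2.1,
      x.1.2 * x.2.1.1 * x.2.2.1 + x.1.1 * x.2.1.2 * x.2.2.1 + x.1.1 * x.2.1.1 * x.2.2.2,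
      x.1.1 * x.2.1.2 * x.2.2.2 + x.1.2 * x.2.1.1 * x.2.2.2 + x.1.2 * x.2.1.2 * x.2.2.1,
      x.1.2 * x.2.1.2 * x.2.2.2⟩ : Cubic ℤ) := by
  simp only [natLinProd, linProd, linForm, Cubic.toPoly, C_mul, C_add]
  ring

lemma polyHeight_natLinProd_le {x : (ℕ × ℕ) × (ℕ × ℕ) × (ℕ × ℕ)} {A B D : ℕ}
    (h1 : x.1.1 ≤ A) (h1' : x.1.2 ≤ A) (h2 : x.2.1.1 ≤ B) (h2' : x.2.1.2 ≤ B)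
    (h3 : x.2.2.1 ≤ D) (h3' : x.2.2.2 ≤ D) : polyHeight (natLinProd x) ≤ 4 * (A * B * D) := by
  have key : ∀ {a b d : ℕ}, a ≤ A → b ≤ B → d ≤ D → a * b * d ≤ A * B * D :=
    fun ha hb hd => Nat.mul_le_mul (Nat.mul_le_mul ha hb) hd
  refine Finset.sup_le fun i _ => ?_
  rw [natLinProd_eq_toPoly]
  rcases lt_or_ge 3 i with hi | hi
  · simp [Cubic.coeff_eq_zero hi]
  · interval_cases i
    · rw [Cubic.coeff_eq_d]
      have := key h1' h2' h3'
      zify at *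
      rw [abs_of_nonneg (by positivity)]
      linarith [show (0 : ℤ) ≤ A * B * D by positivity]
    · rw [Cubic.coeff_eq_c]
      have := key h1 h2' h3'
      have := key h1' h2 h3'
      have := key h1' h2' h3
      zify at *
      rw [abs_of_nonneg (by positivity)]
      linarith [show (0 : ℤ) ≤ A * B * D by positivity]
    · rw [Cubic.coeff_eq_b]
      have := key h1' h2 h3
      have := key h1 h2' h3
      have := key h1 h2 h3'
      zify at *
      rw [abs_of_nonneg (by positivity)]
      linarith [show (0 : ℤ) ≤ A * B * D by positivity]
    · rw [Cubic.coeff_eq_a]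
      have := key h1 h2 h3
      zify at *
      rw [abs_of_nonneg (by positivity)]
      linarith [show (0 : ℤ) ≤ A * B * D by positivity]

lemma linProd_mem_diff {t : ℝ} {x : (ℤ × ℤ) × (ℤ × ℤ) × (ℤ × ℤ)} (h1 : x.1.1 ≠ 0)
    (h2 : x.2.1.1 ≠ 0) (h3 : x.2.2.1 ≠ 0) (ht : (polyHeight (linProd x) : ℝ) ≤ t) :
    linProd x ∈ Rset 3 t \ Rkn 2 3 t := by
  have e1 := natDegree_linForm h1
  have e2 := natDegree_linForm h2
  have e3 := natDegree_linForm h3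
  have n1 := linForm_ne_zero h1
  have n2 := linForm_ne_zero h2
  have n3 := linForm_ne_zero h3
  have e12 : (linForm x.1 * linForm x.2.1).natDegree = 2 := by rw [natDegree_mul n1 n2, e1, e2]
  refine ⟨⟨?_, ht, fun hirr => ?_⟩, ?_⟩
  · rw [linProd, natDegree_mul (mul_ne_zero n1 n2) n3, e12, e3]
  · rw [linProd, Polynomial.map_mul] at hirr
    have hinj : Function.Injective (Int.castRingHom ℚ) := RingHom.injective_int _
    rcases hirr.isUnit_or_isUnit rfl with h | h
    · have := natDegree_eq_zero_of_isUnit h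
      rw [natDegree_map_eq_of_injective hinj, e12] at this
      omega
    · have := natDegree_eq_zero_of_isUnit h
      rw [natDegree_map_eq_of_injective hinj, e3] at this
      omega
  · rintro ⟨-, g, hg, hg2, hdvd⟩
    have hp := hg.prime
    rcases hp.dvd_or_dvd hdvd with h | h
    · rcases hp.dvd_or_dvd h with h | h
      · have := natDegree_le_of_dvd h n1
        omega
      · have := natDegree_le_of_dvd h n2
        omega
    · have := natDegree_le_of_dvd h n3
      omega

lemma natLinProd_mem_diff {M : ℕ} {t : ℝ} (ht : (16 : ℝ) ^ (M + 2) ≤ t)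
    {x : (ℕ × ℕ) × (ℕ × ℕ) × (ℕ × ℕ)} (hx : x ∈ shellTriples M) :
    natLinProd x ∈ Rset 3 t \ Rkn 2 3 t := by
  simp only [shellTriples, Finset.mem_biUnion, Finset.mem_product, Finset.mem_range,
    mem_coprimeShell] at hx
  obtain ⟨h, ⟨hi, hj⟩, hu, hv, hw⟩ := hx
  refine linProd_mem_diff ?_ ?_ ?_ ?_
  · dsimp only; omega
  · dsimp only; omega
  · dsimp only; omega
  · refine le_trans ?_ ht
    have hH := polyHeight_natLinProd_le hu.1.1.1.2 hu.1.1.2.2 hv.1.1.1.2 hv.1.1.2.2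
      hw.1.1.1.2 hw.1.1.2.2
    have he : 4 * (4 ^ (h.1 + 1) * 4 ^ (h.2 + 1) * 4 ^ (2 * M - h.1 - h.2 + 1)) = 16 ^ (M + 2) := by
      rw [← pow_add, ← pow_add, ← pow_succ', show 16 = 4 ^ 2 by norm_num, ← pow_mul]
      congr 1
      omega
    rw [he] at hH
    exact_mod_cast hH

lemma natPair_eq_of_div_eq {u v : ℕ × ℕ} (hu : 1 ≤ u.1) (hv : 1 ≤ v.1) (hu' : u.1.Coprime u.2)
    (hv' : v.1.Coprime v.2) (h : -(u.2 : ℚ) / u.1 = -(v.2 : ℚ) / v.1) : u = v := by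
  have h' : ((u.2 : ℤ) : ℚ) / (u.1 : ℤ) = ((v.2 : ℤ) : ℚ) / (v.1 : ℤ) := by
    push_cast
    rwa [neg_div, neg_div, neg_inj] at h
  have := Rat.div_int_inj (by exact_mod_cast hu) (by exact_mod_cast hv) (by simpa using hu'.symm)
    (by simpa using hv'.symm) h'
  exact Prod.ext (by exact_mod_cast this.2) (by exact_mod_cast this.1)

lemma mem_roots_of_linForm_dvd {p : ℤ[X]} (hp : p ≠ 0) {u : ℕ × ℕ} (hu : 1 ≤ u.1)
    (h : linForm (u.1, u.2) ∣ p) :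
    -(u.2 : ℚ) / u.1 ∈ (p.map (Int.castRingHom ℚ)).roots.toFinset := by
  have hu' : (u.1 : ℚ) ≠ 0 := by positivity
  rw [Multiset.mem_toFinset, mem_roots ((Polynomial.map_ne_zero_iff (RingHom.injective_int _)).mpr hp)]
  refine IsRoot.dvd ?_ (Polynomial.map_dvd (Int.castRingHom ℚ) h)
  simp [linForm, mul_div_cancel₀, hu']

open scoped Classical in
lemma card_shellTriples_fiber_le {M : ℕ} {p : ℤ[X]} (hdeg : p.natDegree = 3) :
    ((shellTriples M).filter fun x => natLinProd x = p).card ≤ 27 := by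
  set R := (p.map (Int.castRingHom ℚ)).roots.toFinset with hR
  have hp : p ≠ 0 := by rintro rfl; simp at hdeg
  have hRcard : R.card ≤ 3 := by
    refine (Multiset.toFinset_card_le _).trans ((card_roots' _).trans ?_)
    rw [natDegree_map_eq_of_injective (RingHom.injective_int _), hdeg]
  let r : ℕ × ℕ → ℚ := fun u => -(u.2 : ℚ) / u.1
  calc _ ≤ (R ×ˢ R ×ˢ R).card := by
        refine Finset.card_le_card_of_injOn (fun x => (r x.1, r x.2.1, r x.2.2)) ?_ ?_
        · intro x hx
          simp only [Finset.coe_filter, Set.mem_ofPred_eq, shellTriples, Finset.mem_biUnion,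
            Finset.mem_product, mem_coprimeShell] at hx
          obtain ⟨⟨h, -, hu, hv, hw⟩, rfl⟩ := hx
          simp only [Finset.coe_product, Set.mem_prod, Finset.mem_coe]
          refine ⟨mem_roots_of_linForm_dvd hp hu.1.1.1.1 ?_, mem_roots_of_linForm_dvd hp hv.1.1.1.1 ?_,
            mem_roots_of_linForm_dvd hp hw.1.1.1.1 ?_⟩
          · exact (dvd_mul_right _ _).mul_right _
          · exact (dvd_mul_left _ _).mul_right _
          · exact dvd_mul_left _ _
        · intro x hx y hy hxy
          simp only [Finset.coe_filter, Set.mem_ofPred_eq, shellTriples, Finset.mem_biUnion,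
            Finset.mem_product, mem_coprimeShell] at hx hy
          obtain ⟨⟨h, -, hu, hv, hw⟩, -⟩ := hx
          obtain ⟨⟨h', -, hu', hv', hw'⟩, -⟩ := hy
          simp only [Prod.mk.injEq] at hxy
          exact Prod.ext (natPair_eq_of_div_eq hu.1.1.1.1 hu'.1.1.1.1 hu.1.2 hu'.1.2 hxy.1)
            (Prod.ext (natPair_eq_of_div_eq hv.1.1.1.1 hv'.1.1.1.1 hv.1.2 hv'.1.2 hxy.2.1)
              (natPair_eq_of_div_eq hw.1.1.1.1 hw'.1.1.1.1 hw.1.2 hw'.1.2 hxy.2.2))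
    _ ≤ 3 * (3 * 3) := by
        rw [Finset.card_product, Finset.card_product]
        gcongr
    _ = 27 := by norm_num

lemma le_ncard_diff {M : ℕ} {t : ℝ} (ht : (16 : ℝ) ^ (M + 2) ≤ t) :
    M ^ 2 * 16 ^ (2 * M) ≤ 27 * (Rset 3 t \ Rkn 2 3 t).ncard := by
  classical
  have h1 : (shellTriples M).card ≤ 27 * ((shellTriples M).image natLinProd).card := by
    refine Finset.card_le_mul_card_image _ _ fun p hp => ?_
    obtain ⟨x, hx, rfl⟩ := Finset.mem_image.mp hp
    exact card_shellTriples_fiber_le (natLinProd_mem_diff ht hx).1.1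
  refine (le_card_shellTriples M).trans (h1.trans (Nat.mul_le_mul_left _ ?_))
  rw [← Set.ncard_coe_finset]
  refine Set.ncard_le_ncard ?_ (finite_diff t)
  intro p hp
  obtain ⟨x, hx, rfl⟩ := Finset.mem_image.mp (Finset.mem_coe.mp hp)
  exact natLinProd_mem_diff ht hx

/-- For `n = 3`: as `t → ∞`, `t²(log t)² ≪ |R_3(t) \ R_{2,3}(t)| ≪ t²(log t)²`. -/
theorem stmt6 :
    ∃ c C : ℝ, 0 < c ∧ 0 < C ∧ ∃ t₀ : ℝ, ∀ t : ℝ, t₀ ≤ t →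
      c * t ^ 2 * Real.log t ^ 2 ≤ ((Rset 3 t \ Rkn 2 3 t).ncard : ℝ) ∧
      ((Rset 3 t \ Rkn 2 3 t).ncard : ℝ) ≤ C * t ^ 2 * Real.log t ^ 2 := by
  refine ⟨1 / (27 * (16 * Real.log 16) ^ 2 * 16 ^ 6), 73728, by positivity, by norm_num, 16 ^ 3,
    fun t ht => ⟨?_, ncard_diff_le (by linarith)⟩⟩
  have ht1 : 1 ≤ t := by linarith
  obtain ⟨m, hm1, hm2⟩ := exists_nat_pow_near ht1 (by norm_num : (1 : ℝ) < 16)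
  have hm3 : 3 ≤ m := by
    have : (16 : ℝ) ^ 3 < 16 ^ (m + 1) := by linarith
    have := (pow_lt_pow_iff_right₀ (by norm_num : (1 : ℝ) < 16)).mp this
    omega
  obtain ⟨M, rfl⟩ : ∃ M, m = M + 2 := ⟨m - 2, by omega⟩
  have hM : (1 : ℝ) ≤ M := by exact_mod_cast (by omega : 1 ≤ M)
  have hlow : (M : ℝ) ^ 2 * 16 ^ (2 * M) ≤ 27 * ((Rset 3 t \ Rkn 2 3 t).ncard : ℝ) := by
    exact_mod_cast le_ncard_diff hm1
  have hl16 : 0 < Real.log 16 := Real.log_pos (by norm_num)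
  have hlog : Real.log t ≤ 16 * Real.log 16 * M := by
    have := Real.log_le_log (by linarith) hm2.le
    rw [Real.log_pow] at this
    push_cast at this
    nlinarith
  have hlog0 : 0 ≤ Real.log t := Real.log_nonneg ht1
  have ht2 : t ^ 2 ≤ 16 ^ 6 * 16 ^ (2 * M) := by
    calc t ^ 2 ≤ (16 ^ (M + 2 + 1)) ^ 2 := by gcongr
      _ = _ := by ring
  calc _ ≤ 1 / (27 * (16 * Real.log 16) ^ 2 * 16 ^ 6) * (16 ^ 6 * 16 ^ (2 * M)) *
        (16 * Real.log 16 * M) ^ 2 := by gcongr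
    _ = (M : ℝ) ^ 2 * 16 ^ (2 * M) / 27 := by field_simp
    _ ≤ _ := by linarith
end
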